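/- Let N, d ∈ ℕ* with N ≥ 2, and let ζ : (ℝ^d)^{N−1} × ℝ^d → ℝ^d be a function such that for each fixed x ∈ ℝ^d, the map y ↦ ζ(y, x) is exchangeable on (ℝ^d)^{N−1} (invariant under permutations of the N−1 coordinates). Then for every (x_1,…,x_N) ∈ (ℝ^d)^N the following telescoping identity holds: Σ_{p=0}^{N−1} (−1)^p Σ_{1 ≤ i_1 < ⋯ < i_{p+1} ≤ N} ζ( (x_1 repeated p times, followed by the coordinates (x_j) for j ∈ {1,…,N} \ {i_1,…,i_{p+1}} in increasing order of j), x_1 ) = ζ( (x_2,…,x_N), x_1 ). (Each first argument of ζ in the sum is an (N−1)-tuple, since p + (N − (p+1)) = N − 1.) -/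

import Mathlib

theorem telescoping_perm_aux {n : ℕ} {E F : Type*} [DecidableEq E] (z : E)
    (ζ : (Fin n → E) → F)
    (hζ : ∀ (π : Equiv.Perm (Fin n)) (y : Fin n → E), ζ (fun m => y (π m)) = ζ y)
    (l₁ l₂ : List E) (h : l₁.Perm l₂) (hl : l₁.length = n) :
    ζ (fun m => l₁.getD m z) = ζ (fun m => l₂.getD m z) := by
  subst hl
  have h2 : l₂.length = l₁.length := h.length_eq.symm
  have hinj : Function.Injective (fun i => Fin.cast h2 (h.idxBij i)) :=
    (Fin.cast_injective h2).comp h.idxBij_injective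
  have := hζ (Equiv.ofBijective _ (Finite.injective_iff_bijective.1 hinj))
    (fun m => l₂.getD m z)
  rw [← this]
  congr 1
  funext m
  have e := h.getElem_idxBij_eq_getElem m
  rw [Equiv.ofBijective_apply, List.getD_eq_getElem _ _ m.2, Fin.val_cast,
    List.getD_eq_getElem _ _ (h.idxBij m).2]
  exact e.symm

theorem telescoping_aux {n : ℕ} {E F : Type*} [AddCommGroup F] [Module ℝ F] (z : E)
    (ζ : (Fin n → E) → F)
    (hζ : ∀ (π : Equiv.Perm (Fin n)) (y : Fin n → E), ζ (fun m => y (π m)) = ζ y)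
    (x : Fin (n + 1) → E) :
    ∑ p ∈ Finset.range (n + 1), (-1 : ℝ) ^ p •
      ∑ S ∈ Finset.powersetCard (p + 1) (Finset.univ : Finset (Fin (n + 1))),
        ζ (fun m : Fin n =>
            (List.replicate p (x 0) ++ (Finset.sort Sᶜ (· ≤ ·)).map x).getD m z)
      = ζ (fun m : Fin n => x m.succ) := by
  classical
  let F0 : ℕ → Finset (Fin (n + 1)) → F := fun p S =>
    (-1 : ℝ) ^ p • ζ (fun m : Fin n =>
            (List.replicate p (x 0) ++ (Finset.sort Sᶜ (· ≤ ·)).map x).getD m z)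
  let f : Finset (Fin (n + 1)) → F := fun S => if S = ∅ then 0 else F0 (S.card - 1) S
  have h1 : ∑ S ∈ (Finset.univ : Finset (Fin (n + 1))).powerset, f S =
      ∑ p ∈ Finset.range (n + 1), (-1 : ℝ) ^ p •
      ∑ S ∈ Finset.powersetCard (p + 1) (Finset.univ : Finset (Fin (n + 1))),
        ζ (fun m : Fin n =>
            (List.replicate p (x 0) ++ (Finset.sort Sᶜ (· ≤ ·)).map x).getD m z) := by
    rw [Finset.sum_powerset, Finset.card_univ, Fintype.card_fin, Finset.sum_range_succ']
    have h0 : ∑ t ∈ Finset.powersetCard 0 (Finset.univ : Finset (Fin (n + 1))), f t = 0 := by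
      simp [f]
    rw [h0, add_zero]
    refine Finset.sum_congr rfl fun p _ => ?_
    rw [Finset.smul_sum]
    refine Finset.sum_congr rfl fun S hS => ?_
    have hc := (Finset.mem_powersetCard.1 hS).2
    have hne : S ≠ ∅ := by
      rintro rfl
      simp at hc
    simp only [f, if_neg hne, hc, F0, Nat.add_sub_cancel]
  rw [← h1]
  have hins : (Finset.univ : Finset (Fin (n + 1))) = insert 0 (Finset.univ.erase 0) := by
    simp
  rw [hins, Finset.sum_powerset_insert (Finset.notMem_erase _ _), ← Finset.sum_add_distrib,
    Finset.sum_eq_single ∅]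
  · have hf0 : f ∅ = 0 := by simp [f]
    rw [hf0, zero_add]
    simp only [f, F0, insert_empty_eq, Finset.singleton_ne_empty, if_false,
      Finset.card_singleton, Nat.sub_self, pow_zero, one_smul, List.replicate_zero,
      List.nil_append]
    have hp : ((Finset.sort ({0}ᶜ : Finset (Fin (n + 1))) (· ≤ ·)).map x).Perm
        (List.ofFn fun m : Fin n => x m.succ) := by
      have : (Finset.sort ({0}ᶜ : Finset (Fin (n + 1))) (· ≤ ·)).Perm
          (List.ofFn fun m : Fin n => m.succ) := by
        rw [List.perm_ext_iff_of_nodup (Finset.sort_nodup _ _)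
          (List.nodup_ofFn.2 (Fin.succ_injective n))]
        intro a
        simp [List.mem_ofFn, Fin.exists_succ_eq]
      have := this.map x
      rwa [List.map_ofFn] at this
    rw [telescoping_perm_aux z ζ hζ _ _ hp (by simp [Finset.card_compl])]
    congr 1
    funext m
    rw [List.getD_eq_getElem _ _ (by simp)]
    simp
  · intro S hS hne
    have h0 : (0 : Fin (n + 1)) ∉ S := fun h => by
      simpa using Finset.mem_powerset.1 hS h
    obtain ⟨p, hp⟩ : ∃ p, S.card = p + 1 :=
      Nat.exists_eq_succ_of_ne_zero (by simpa using hne)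
    have hcard : S.card + Sᶜ.card = n + 1 := by simp [Finset.card_add_card_compl]
    simp only [f, F0, if_neg hne, if_neg (Finset.insert_ne_empty _ _),
      Finset.card_insert_of_notMem h0, hp, Nat.add_sub_cancel]
    have hperm : (List.replicate p (x 0) ++ (Finset.sort Sᶜ (· ≤ ·)).map x).Perm
        (List.replicate (p + 1) (x 0) ++
          (Finset.sort (insert 0 S)ᶜ (· ≤ ·)).map x) := by
      have hs : (Finset.sort Sᶜ (· ≤ ·)).Perm
          (0 :: Finset.sort (insert 0 S)ᶜ (· ≤ ·)) := by
        rw [List.perm_ext_iff_of_nodup (Finset.sort_nodup _ _)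
          (List.nodup_cons.2 ⟨by simp, Finset.sort_nodup _ _⟩)]
        intro a
        by_cases ha : a = 0
        · subst ha; simp [h0]
        · simp [ha]
      refine ((hs.map x).append_left _).trans ?_
      rw [List.map_cons, List.replicate_succ, List.cons_append]
      exact List.perm_middle
    rw [telescoping_perm_aux z ζ hζ _ _ hperm (by
      rw [List.length_append, List.length_replicate, List.length_map, Finset.length_sort]; omega), pow_succ,
      mul_neg_one, neg_smul, add_neg_cancel]
  · intro h
    simp at h


/-- The telescoping identity behind the construction of a D-exchangeable representation of
the gradient of an exchangeable function (Lemma 2.2 of the paper):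
for `ζ : (ℝ^d)^{N-1} × ℝ^d → ℝ^d` exchangeable in its first (tuple) argument,
`∑_{p=0}^{N-1} (-1)^p ∑_{1 ≤ i_1 < ⋯ < i_{p+1} ≤ N}
   ζ((x_1,…,x_1 (p times), (x_j)_{j ∉ {i_1,…,i_{p+1}}} increasing), x_1)
 = ζ((x_2,…,x_N), x_1)`.
Finsets `S` of cardinality `p+1` enumerate the increasing tuples `i_1 < ⋯ < i_{p+1}`,
and the tuple argument is encoded as the (length `N-1`) list
`replicate p x_1 ++ map x (sort Sᶜ)`. -/
theorem telescoping_identity_for_D_exchangeable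
    {N d : ℕ} (hN : 2 ≤ N) (hd : 0 < d)
    (ζ : (Fin (N - 1) → Fin d → ℝ) → (Fin d → ℝ) → (Fin d → ℝ))
    (hζ : ∀ (v : Fin d → ℝ) (π : Equiv.Perm (Fin (N - 1))) (y : Fin (N - 1) → Fin d → ℝ),
      ζ (fun m => y (π m)) v = ζ y v)
    (x : Fin N → Fin d → ℝ) :
    ∑ p ∈ Finset.range N, (-1 : ℝ) ^ p •
      ∑ S ∈ Finset.powersetCard (p + 1) (Finset.univ : Finset (Fin N)),
        ζ (fun m : Fin (N - 1) =>
            (List.replicate p (x ⟨0, by omega⟩) ++ (Finset.sort Sᶜ (· ≤ ·)).map x).getD m 0)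
          (x ⟨0, by omega⟩)
      = ζ (fun m : Fin (N - 1) => x ⟨m.1 + 1, by have := m.2; omega⟩) (x ⟨0, by omega⟩) := by
  obtain ⟨n, rfl⟩ : ∃ n, N = n + 1 := ⟨N - 1, by omega⟩
  exact telescoping_aux (0 : Fin d → ℝ) (fun y => ζ y (x 0)) (fun π y => hζ (x 0) π y) x
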